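/- For every polynomial p ∈ ℝ[X] and all real numbers x and t with |t·x| < 1, HasSum (fun n => t^n/n! * (E^[n] p).eval x) (p.eval (x/(1 − t*x))), where E : ℝ[X] → ℝ[X] is the linear operator E q = X²·q' (q' the formal derivative) and E^[n] is its n-th functional iterate. (The exponential shift identity e^{t x² ∂_x} f(x) = f(x/(1−tx)) for polynomials.) -/

import Mathlib

open Polynomial

/-- The operator `E = x² ∂ₓ`. -/
noncomputable def Eop (p : Polynomial ℝ) : Polynomial ℝ :=
  X ^ 2 * derivative p

theorem Eop_iterate_add (n : ℕ) (p q : Polynomial ℝ) :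
    Eop^[n] (p + q) = Eop^[n] p + Eop^[n] q := by
  induction n generalizing p q with
  | zero => rfl
  | succ n ih =>
    have hadd : Eop (p + q) = Eop p + Eop q := by simp [Eop, mul_add]
    simp only [Function.iterate_succ_apply, hadd, ih]

theorem Eop_monomial (k : ℕ) (a : ℝ) :
    Eop (monomial k a) = monomial (k + 1) (a * k) := by
  rw [Eop, derivative_monomial, X_pow_eq_monomial, monomial_mul_monomial, one_mul]
  cases k with
  | zero => simp
  | succ k => rw [Nat.add_sub_cancel, show 2 + k = k + 1 + 1 by ring]

theorem Eop_iterate_monomial (n k : ℕ) (a : ℝ) :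
    Eop^[n] (monomial k a) = monomial (k + n) (a * (k.ascFactorial n : ℝ)) := by
  induction n with
  | zero => simp
  | succ n ih =>
    rw [Function.iterate_succ_apply', ih, Eop_monomial, Nat.ascFactorial_succ]
    push_cast
    congr 1
    ring

theorem hasSum_Eop_iterate_monomial (k : ℕ) (a x t : ℝ) (h : |t * x| < 1) :
    HasSum (fun n : ℕ => t ^ n / (n.factorial : ℝ) * (Eop^[n] (monomial k a)).eval x)
      ((monomial k a).eval (x / (1 - t * x))) := by
  simp only [Eop_iterate_monomial, eval_monomial]
  cases k with
  | zero =>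
    convert! hasSum_ite_eq (0 : ℕ) a using 1
    · ext n
      cases n <;> simp [Nat.zero_ascFactorial]
    · simp
  | succ k =>
    convert! (hasSum_choose_mul_geometric_of_norm_lt_one k
      (by simpa using h : ‖t * x‖ < 1)).mul_left (a * x ^ (k + 1)) using 1
    · ext n
      have hn : (n.factorial : ℝ) ≠ 0 := by positivity
      rw [Nat.ascFactorial_eq_factorial_mul_choose, add_comm k n, Nat.choose_symm_add]
      push_cast
      field_simp
      ring
    · rw [div_pow]
      ring

/-- The exponential shift identity `e^{t x² ∂ₓ} f(x) = f(x/(1 - t x))` for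
polynomials: `∑ₙ tⁿ/n! · ((x²∂ₓ)ⁿ p)(x) = p(x/(1 - t x))` whenever `|t x| < 1`. -/
theorem exp_shift_x_sq (p : Polynomial ℝ) (x t : ℝ) (h : |t * x| < 1) :
    HasSum (fun n : ℕ => t ^ n / (n.factorial : ℝ) * (Eop^[n] p).eval x)
      (p.eval (x / (1 - t * x))) := by
  induction p using Polynomial.induction_on' with
  | add p q hp hq =>
    simpa only [Eop_iterate_add, eval_add, mul_add] using hp.add hq
  | monomial k a => exact hasSum_Eop_iterate_monomial k a x t h
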